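/- arXiv:1902.03552 — 11 statements merged into one kernel-verified Lean document; each statement's English description precedes it below -/
import Mathlib

section
/- The function G is strictly increasing on [0, ∞): for all real numbers x, y with 0 ≤ x < y, one has G(x) < G(y). -/
open Real

/-- `G x = (e^{x²}/x) ∫_0^x e^{-t²} dt` for `x ≠ 0`, and `G 0 = 1`. -/
noncomputable def G (x : ℝ) : ℝ :=
  if x = 0 then 1 else (Real.exp (x ^ 2) / x) * ∫ t in (0:ℝ)..x, Real.exp (-t ^ 2)

lemma G_eq_integral (x : ℝ) :
    G x = ∫ s in (0:ℝ)..1, Real.exp (x ^ 2 * (1 - s ^ 2)) := by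
  unfold G
  split_ifs with h
  · subst h
    simp
  · have h1 := intervalIntegral.mul_integral_comp_mul_left
      (a := (0:ℝ)) (b := 1) (f := fun t : ℝ => Real.exp (-t ^ 2)) x
    rw [mul_zero, mul_one] at h1
    rw [← h1, ← mul_assoc, div_mul_cancel₀ _ h, ← intervalIntegral.integral_const_mul]
    congr 1
    ext s
    rw [← Real.exp_add]
    congr 1
    ring

/-- `G` is strictly increasing on `[0, ∞)`. -/
theorem G_strictMono_on_nonneg : ∀ x y : ℝ, 0 ≤ x → x < y → G x < G y := by
  intro x y hx hxy
  have hsq : x ^ 2 < y ^ 2 := by nlinarith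
  rw [G_eq_integral, G_eq_integral]
  apply intervalIntegral.integral_lt_integral_of_continuousOn_of_le_of_exists_lt zero_lt_one
  · fun_prop
  · fun_prop
  · intro s hs
    apply Real.exp_le_exp.mpr
    have : s ^ 2 ≤ 1 := by nlinarith [hs.1, hs.2]
    nlinarith
  · refine ⟨0, by simp, ?_⟩
    apply Real.exp_lt_exp.mpr
    simpa using hsq
end

section
/- For every x > 0, G is differentiable at x with derivative G'(x) = 2·e^{x²}·∫_0^x e^{−t²} dt − (e^{x²}/x²)·∫_0^x e^{−t²} dt + 1/x, and moreover G'(x) > 0. -/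
open Real

lemma I_hasDerivAt (x : ℝ) :
    HasDerivAt (fun x : ℝ => ∫ t in (0:ℝ)..x, Real.exp (-t ^ 2)) (Real.exp (-x ^ 2)) x := by
  have hc : Continuous (fun t : ℝ => Real.exp (-t ^ 2)) := by fun_prop
  exact intervalIntegral.integral_hasDerivAt_right (hc.intervalIntegrable _ _)
    (hc.stronglyMeasurableAtFilter _ _) hc.continuousAt

lemma I_pos (x : ℝ) (hx : 0 < x) : 0 < ∫ t in (0:ℝ)..x, Real.exp (-t ^ 2) := by
  have hc : Continuous (fun t : ℝ => Real.exp (-t ^ 2)) := by fun_prop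
  exact intervalIntegral.intervalIntegral_pos_of_pos (hc.intervalIntegrable _ _)
    (fun t => Real.exp_pos _) hx

lemma H_hasDerivAt (x : ℝ) :
    HasDerivAt (fun x : ℝ => (2 * x ^ 2 - 1) * (∫ t in (0:ℝ)..x, Real.exp (-t ^ 2))
      + x * Real.exp (-x ^ 2)) (4 * x * ∫ t in (0:ℝ)..x, Real.exp (-t ^ 2)) x := by
  have h1 : HasDerivAt (fun x : ℝ => 2 * x ^ 2 - 1) (2 * (2 * x)) x := by
    simpa using ((hasDerivAt_pow 2 x).const_mul 2).sub_const 1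
  have h2 : HasDerivAt (fun x : ℝ => Real.exp (-x ^ 2)) (Real.exp (-x ^ 2) * (-(2 * x))) x := by
    simpa using ((hasDerivAt_pow 2 x).neg).exp
  refine ((h1.mul (I_hasDerivAt x)).add ((hasDerivAt_id' x).mul h2)).congr_deriv ?_
  ring

lemma H_pos (x : ℝ) (hx : 0 < x) :
    0 < (2 * x ^ 2 - 1) * (∫ t in (0:ℝ)..x, Real.exp (-t ^ 2)) + x * Real.exp (-x ^ 2) := by
  have hm : StrictMonoOn (fun x : ℝ => (2 * x ^ 2 - 1) * (∫ t in (0:ℝ)..x, Real.exp (-t ^ 2))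
      + x * Real.exp (-x ^ 2)) (Set.Ici 0) := by
    apply strictMonoOn_of_deriv_pos (convex_Ici 0)
    · exact fun y _ => (H_hasDerivAt y).continuousAt.continuousWithinAt
    · intro y hy
      rw [interior_Ici] at hy
      have hy0 : 0 < y := hy
      rw [(H_hasDerivAt y).deriv]
      have := I_pos y hy0
      positivity
  have := hm (Set.mem_Ici.2 le_rfl) (Set.mem_Ici.2 hx.le) hx
  simpa using this

/-- For every `x > 0`, `G` is differentiable at `x` with derivative
`G'(x) = 2 e^{x²} ∫_0^x e^{-t²} dt - (e^{x²}/x²) ∫_0^x e^{-t²} dt + 1/x`, which is positive. -/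
theorem G_hasDerivAt_pos (x : ℝ) (hx : 0 < x) :
    HasDerivAt G
      (2 * Real.exp (x ^ 2) * (∫ t in (0:ℝ)..x, Real.exp (-t ^ 2))
        - Real.exp (x ^ 2) / x ^ 2 * (∫ t in (0:ℝ)..x, Real.exp (-t ^ 2)) + 1 / x) x ∧
    0 < 2 * Real.exp (x ^ 2) * (∫ t in (0:ℝ)..x, Real.exp (-t ^ 2))
        - Real.exp (x ^ 2) / x ^ 2 * (∫ t in (0:ℝ)..x, Real.exp (-t ^ 2)) + 1 / x := by
  have hne : x ≠ 0 := hx.ne'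
  have hee : Real.exp (x ^ 2) * Real.exp (-x ^ 2) = 1 := by
    rw [← Real.exp_add]; simp
  constructor
  · have h1 : HasDerivAt (fun x : ℝ => Real.exp (x ^ 2)) (Real.exp (x ^ 2) * (2 * x)) x := by
      simpa using (hasDerivAt_pow 2 x).exp
    have h2 := (h1.div (hasDerivAt_id' x) hne).mul (I_hasDerivAt x)
    have h3 := h2.congr_of_eventuallyEq (f₁ := G) (by
      filter_upwards [isOpen_ne.mem_nhds hne] with y hy
      have hy' : y ≠ 0 := hy
      simp [G, hy'])
    refine h3.congr_deriv ?_
    simp only [Pi.div_apply]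
    have h4 : Real.exp (x ^ 2) / x * Real.exp (-x ^ 2) = 1 / x := by
      rw [div_mul_eq_mul_div, hee]
    rw [h4]
    field_simp
  · have h := H_pos x hx
    have key : 2 * Real.exp (x ^ 2) * (∫ t in (0:ℝ)..x, Real.exp (-t ^ 2))
        - Real.exp (x ^ 2) / x ^ 2 * (∫ t in (0:ℝ)..x, Real.exp (-t ^ 2)) + 1 / x
        = Real.exp (x ^ 2) / x ^ 2 * ((2 * x ^ 2 - 1) * (∫ t in (0:ℝ)..x, Real.exp (-t ^ 2))
          + x * Real.exp (-x ^ 2)) := by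
      have h5 : 1 / x = Real.exp (x ^ 2) * Real.exp (-x ^ 2) / x := by rw [hee]
      rw [h5]
      field_simp
    rw [key]
    have := Real.exp_pos (x ^ 2)
    positivity
end

section
/- For all x ≥ 0, (1 − 2x²)·G(x) ≤ 1. -/
open Real

/-- For all `x ≥ 0`, `(1 - 2x²) G x ≤ 1`. -/
theorem one_sub_two_sq_mul_G_le_one : ∀ x : ℝ, 0 ≤ x → (1 - 2 * x ^ 2) * G x ≤ 1 := by
  intro x hx
  unfold G
  split_ifs with h
  · subst h; norm_num
  have hx' : 0 < x := lt_of_le_of_ne hx (Ne.symm h)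
  have hI0 : 0 ≤ ∫ t in (0:ℝ)..x, Real.exp (-t ^ 2) :=
    intervalIntegral.integral_nonneg hx (fun t _ => (Real.exp_pos _).le)
  have hI1 : (∫ t in (0:ℝ)..x, Real.exp (-t ^ 2)) ≤ x := by
    have hm : (∫ t in (0:ℝ)..x, Real.exp (-t ^ 2)) ≤ ∫ t in (0:ℝ)..x, (1:ℝ) := by
      apply intervalIntegral.integral_mono_on hx
      · exact (by fun_prop : Continuous fun t : ℝ => Real.exp (-t ^ 2)).intervalIntegrable _ _
      · exact intervalIntegrable_const
      · intro t _
        exact Real.exp_le_one_iff.mpr (by nlinarith [sq_nonneg t])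
    simpa using hm
  generalize (∫ t in (0:ℝ)..x, Real.exp (-t ^ 2)) = I at hI0 hI1
  have hE := Real.exp_pos (x ^ 2)
  have hG0 : 0 ≤ Real.exp (x ^ 2) / x * I := by positivity
  have hG1 : Real.exp (x ^ 2) / x * I ≤ Real.exp (x ^ 2) := by
    rw [div_mul_eq_mul_div, div_le_iff₀ hx']
    exact mul_le_mul_of_nonneg_left hI1 hE.le
  rcases le_total (1 - 2 * x ^ 2) 0 with h1 | h1
  · linarith [mul_nonpos_of_nonpos_of_nonneg h1 hG0]
  · have h2 := mul_le_mul_of_nonneg_left hG1 h1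
    have h3 : (1 - x ^ 2) * Real.exp (x ^ 2) ≤ 1 := by
      have h4 := Real.add_one_le_exp (-(x ^ 2))
      have h5 : Real.exp (-(x ^ 2)) * Real.exp (x ^ 2) = 1 := by
        rw [← Real.exp_add]; simp
      nlinarith [mul_le_mul_of_nonneg_right h4 hE.le]
    nlinarith [mul_nonneg (sq_nonneg x) hE.le]
end

section
/- G admits the second-order expansion G(x) = 1 + (2/3)·x² + o(x²) as x → 0⁺; that is, (G(x) − 1 − (2/3)·x²)/x² → 0 as x → 0 from the right. -/
open Real Filter

/-- `G(x) = 1 + (2/3) x² + o(x²)` as `x → 0⁺`: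
`(G x - 1 - (2/3) x²)/x² → 0` as `x → 0` from the right. -/
theorem G_second_order_expansion :
    Tendsto (fun x : ℝ => (G x - 1 - 2 / 3 * x ^ 2) / x ^ 2)
      (nhdsWithin 0 (Set.Ioi 0)) (nhds 0) := by
  have key : ∀ x : ℝ, 0 < x → x < 1 → |(G x - 1 - 2 / 3 * x ^ 2) / x ^ 2| ≤ 2 * x ^ 2 := by
    intro x hx hx1
    have hb : ∀ t : ℝ, 0 ≤ t → t ≤ 1 → |Real.exp (-t ^ 2) - 1 - (-t ^ 2)| ≤ (-t ^ 2) ^ 2 := by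
      intro t h0 h1
      apply Real.abs_exp_sub_one_sub_id_le
      rw [abs_neg, abs_of_nonneg (by positivity)]
      nlinarith
    have hE : |Real.exp (x ^ 2) - 1 - x ^ 2| ≤ (x ^ 2) ^ 2 := by
      apply Real.abs_exp_sub_one_sub_id_le
      rw [abs_of_nonneg (by positivity)]
      nlinarith
    have hE1 : x ^ 2 + 1 ≤ Real.exp (x ^ 2) := Real.add_one_le_exp _
    have hE2 := (abs_le.1 hE).2
    have hL : ∫ t in (0:ℝ)..x, (1 - t ^ 2) = x - x ^ 3 / 3 := by
      rw [intervalIntegral.integral_sub (Continuous.intervalIntegrable (by fun_prop) _ _)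
        (Continuous.intervalIntegrable (by fun_prop) _ _)]
      simp
      norm_num
    have hU : ∫ t in (0:ℝ)..x, ((1 - t ^ 2) + t ^ 4) = x - x ^ 3 / 3 + x ^ 5 / 5 := by
      rw [intervalIntegral.integral_add (Continuous.intervalIntegrable (by fun_prop) _ _)
        (Continuous.intervalIntegrable (by fun_prop) _ _), hL]
      simp
      norm_num
    have h1 : x - x ^ 3 / 3 ≤ ∫ t in (0:ℝ)..x, Real.exp (-t ^ 2) := by
      rw [← hL]
      apply intervalIntegral.integral_mono_on hx.le
        (Continuous.intervalIntegrable (by fun_prop) _ _)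
        (Continuous.intervalIntegrable (by fun_prop) _ _)
      intro t ht
      have := Real.add_one_le_exp (-t ^ 2)
      linarith
    have h2 : ∫ t in (0:ℝ)..x, Real.exp (-t ^ 2) ≤ x - x ^ 3 / 3 + x ^ 5 / 5 := by
      rw [← hU]
      apply intervalIntegral.integral_mono_on hx.le
        (Continuous.intervalIntegrable (by fun_prop) _ _)
        (Continuous.intervalIntegrable (by fun_prop) _ _)
      intro t ht
      have := (abs_le.1 (hb t ht.1 (ht.2.trans hx1.le))).2
      nlinarith
    have hG : G x = Real.exp (x ^ 2) * ((∫ t in (0:ℝ)..x, Real.exp (-t ^ 2)) / x) := by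
      rw [G, if_neg hx.ne']
      ring
    have hJ1 : 1 - x ^ 2 / 3 ≤ (∫ t in (0:ℝ)..x, Real.exp (-t ^ 2)) / x := by
      rw [le_div_iff₀ hx]
      linarith
    have hJ2 : (∫ t in (0:ℝ)..x, Real.exp (-t ^ 2)) / x
        ≤ 1 - x ^ 2 / 3 + (x ^ 2) ^ 2 / 5 := by
      rw [div_le_iff₀ hx]
      linarith
    rw [hG]
    generalize (∫ t in (0:ℝ)..x, Real.exp (-t ^ 2)) / x = J at hJ1 hJ2 ⊢
    generalize Real.exp (x ^ 2) = E at hE1 hE2 ⊢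
    have hs0 : 0 < x ^ 2 := by positivity
    have hs1 : x ^ 2 < 1 := by nlinarith
    generalize x ^ 2 = s at *
    have hlo : (s + 1) * (1 - s / 3) ≤ E * J :=
      mul_le_mul hE1 hJ1 (by linarith) (by linarith)
    have hup : E * J ≤ (1 + s + s ^ 2) * (1 - s / 3 + s ^ 2 / 5) :=
      mul_le_mul (by linarith) hJ2 (by linarith) (by positivity)
    have hs3 : 0 < s ^ 3 := by positivity
    have hs4 : s ^ 4 ≤ s ^ 2 := pow_le_pow_of_le_one hs0.le hs1.le (by norm_num)
    rw [abs_div, abs_of_pos hs0, div_le_iff₀ hs0, abs_le]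
    constructor <;> nlinarith
  have hlim : Tendsto (fun x : ℝ => 2 * x ^ 2) (nhdsWithin 0 (Set.Ioi 0)) (nhds 0) := by
    have : Tendsto (fun x : ℝ => 2 * x ^ 2) (nhds 0) (nhds (2 * 0 ^ 2)) :=
      Continuous.tendsto (by fun_prop) 0
    simp only [ne_eq, OfNat.ofNat_ne_zero, not_false_eq_true, zero_pow, mul_zero] at this
    exact this.mono_left nhdsWithin_le_nhds
  apply squeeze_zero_norm' _ hlim
  filter_upwards [Ioo_mem_nhdsGT (show (0:ℝ) < 1 by norm_num)] with x hx
  exact key x hx.1 hx.2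
end

section
/- The threshold diverges as β approaches mse_∞: if v : ℝ → ℝ satisfies, for every β ∈ [mse_Y, mse_∞), v(β) ≥ 0 and (mse_∞ − β)·G((√θ/σ)·v(β)) = mse_∞ − mse_Y, then v(β) → ∞ as β → mse_∞ from the left. -/
open Real MeasureTheory Filter Set

/-- `mse_∞ = σ²/(2θ)`. -/
noncomputable def mseInf (θ σ : ℝ) : ℝ := σ ^ 2 / (2 * θ)

/-- `mse_Y = (σ²/(2θ)) ∫ (1 - e^{-2θy}) dμ(y)`. -/
noncomputable def mseY (θ σ : ℝ) (μ : Measure ℝ) : ℝ :=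
  σ ^ 2 / (2 * θ) * ∫ y, (1 - Real.exp (-(2 * θ * y))) ∂μ

theorem G_le_exp (x : ℝ) (hx : 0 ≤ x) : G x ≤ Real.exp (x ^ 2) := by
  unfold G
  split_ifs with h
  · simp [h]
  · have hx' : 0 < x := lt_of_le_of_ne hx (Ne.symm h)
    have hI : ∫ t in (0:ℝ)..x, Real.exp (-t ^ 2) ≤ x := by
      have h1 : ∫ t in (0:ℝ)..x, Real.exp (-t ^ 2) ≤ ∫ t in (0:ℝ)..x, (1:ℝ) := by
        apply intervalIntegral.integral_mono_on hx
        · exact Continuous.intervalIntegrable (by fun_prop) _ _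
        · exact Continuous.intervalIntegrable (by fun_prop) _ _
        · intro t _
          rw [Real.exp_le_one_iff]
          nlinarith [sq_nonneg t]
      simpa using h1
    calc (Real.exp (x ^ 2) / x) * ∫ t in (0:ℝ)..x, Real.exp (-t ^ 2)
        ≤ (Real.exp (x ^ 2) / x) * x := by gcongr
      _ = Real.exp (x ^ 2) := by field_simp

theorem mseY_lt_mseInf (θ σ : ℝ) (hθ : 0 < θ) (hσ : 0 < σ)
    (μ : Measure ℝ) [IsProbabilityMeasure μ] (hsupp : ∀ᵐ y ∂μ, 0 ≤ y) :
    mseY θ σ μ < mseInf θ σ := by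
  have hi : Integrable (fun y : ℝ => Real.exp (-(2 * θ * y))) μ := by
    refine Integrable.of_bound (Continuous.aestronglyMeasurable (by fun_prop)) 1 ?_
    filter_upwards [hsupp] with y hy
    rw [Real.norm_eq_abs, Real.abs_exp, Real.exp_le_one_iff]
    have : 0 ≤ 2 * θ * y := by positivity
    linarith
  have hp : 0 < ∫ y, Real.exp (-(2 * θ * y)) ∂μ := integral_exp_pos hi
  unfold mseY mseInf
  rw [integral_sub (integrable_const _) hi]
  simp only [integral_const, probReal_univ, smul_eq_mul, mul_one]
  have : 0 < σ ^ 2 / (2 * θ) := by positivity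
  nlinarith [mul_pos this hp]

/-- The threshold diverges as `β → mse_∞⁻`. -/
theorem threshold_tendsto_atTop (θ σ : ℝ) (hθ : 0 < θ) (hσ : 0 < σ)
    (μ : Measure ℝ) [IsProbabilityMeasure μ] (hsupp : ∀ᵐ y ∂μ, 0 ≤ y)
    (hint : Integrable (fun y : ℝ => y) μ) (hmean : 0 < ∫ y, y ∂μ)
    (v : ℝ → ℝ)
    (hv : ∀ β ∈ Ico (mseY θ σ μ) (mseInf θ σ), 0 ≤ v β ∧
      (mseInf θ σ - β) * G (Real.sqrt θ / σ * v β) = mseInf θ σ - mseY θ σ μ) :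
    Tendsto v (nhdsWithin (mseInf θ σ) (Iio (mseInf θ σ))) atTop := by
  have hlt := mseY_lt_mseInf θ σ hθ hσ μ hsupp
  set a := mseInf θ σ with ha
  set b := mseY θ σ μ with hb
  have hk : 0 < Real.sqrt θ / σ := by positivity
  set k := Real.sqrt θ / σ with hkdef
  rw [tendsto_atTop]
  intro C
  set M := Real.exp ((k * C) ^ 2) with hM
  have hMp : 0 < M := Real.exp_pos _
  have hd : 0 < (a - b) / M := div_pos (by linarith) hMp
  have h1 : ∀ᶠ β in nhdsWithin a (Iio a), β ∈ Ioo (max b (a - (a - b) / M)) a :=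
    Ioo_mem_nhdsLT (max_lt hlt (by linarith))
  filter_upwards [h1] with β hβ
  obtain ⟨hβ1, hβ2⟩ := hβ
  obtain ⟨hβb, hβd⟩ := max_lt_iff.1 hβ1
  obtain ⟨hv0, hveq⟩ := hv β ⟨hβb.le, hβ2⟩
  by_contra! hC
  have h2 : G (k * v β) ≤ M := by
    refine (G_le_exp _ (by positivity)).trans ?_
    rw [hM]
    gcongr
  have h3 : (a - β) * G (k * v β) ≤ (a - β) * M :=
    mul_le_mul_of_nonneg_left h2 (by linarith)
  have h4 : (a - β) * M < a - b := by
    rw [← lt_div_iff₀ hMp]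
    linarith
  linarith
end

section
/- Strict gradient inequality inside the continuation region: let mse_Y ≤ β < mse_∞ and let v_* ≥ 0 satisfy (mse_∞ − β)·G((√θ/σ)·v_*) = mse_∞ − mse_Y. Then for every v with 0 < v < v_*, one has −v/θ + (σ/θ^{3/2} − 2β/(σ·√θ))·F((√θ/σ)·v) < −2γ·v. -/
open Real MeasureTheory Filter Set

/-- `F x = e^{x²} ∫_0^x e^{-t²} dt`. -/
noncomputable def F (x : ℝ) : ℝ := Real.exp (x ^ 2) * ∫ t in (0:ℝ)..x, Real.exp (-t ^ 2)

/-- `γ = (1/(2θ)) ∫ (1 - e^{-2θy}) dμ(y)`. -/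
noncomputable def gam (θ : ℝ) (μ : Measure ℝ) : ℝ :=
  1 / (2 * θ) * ∫ y, (1 - Real.exp (-(2 * θ * y))) ∂μ

lemma G_eq (x : ℝ) (hx : 0 < x) :
    G x = ∫ u in (0:ℝ)..1, Real.exp (x ^ 2 * (1 - u ^ 2)) := by
  have h := intervalIntegral.mul_integral_comp_mul_left (a := 0) (b := 1)
    (f := fun t : ℝ => Real.exp (-t ^ 2)) x
  simp only [mul_zero, mul_one] at h
  unfold G
  rw [if_neg hx.ne', ← h, ← mul_assoc, div_mul_cancel₀ _ hx.ne',
    ← intervalIntegral.integral_const_mul]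
  congr 1
  ext u
  rw [← Real.exp_add]
  congr 1
  ring

lemma G_lt (x y : ℝ) (hx : 0 < x) (hxy : x < y) : G x < G y := by
  rw [G_eq x hx, G_eq y (hx.trans hxy)]
  have hsq : x ^ 2 < y ^ 2 := by nlinarith
  apply intervalIntegral.integral_lt_integral_of_continuousOn_of_le_of_exists_lt one_pos
  · fun_prop
  · fun_prop
  · intro u hu
    apply Real.exp_le_exp.2
    have : 0 ≤ 1 - u ^ 2 := by nlinarith [hu.1, hu.2]
    exact mul_le_mul_of_nonneg_right hsq.le this
  · refine ⟨0, by simp, ?_⟩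
    apply Real.exp_lt_exp.2
    linarith

/-- Strict gradient inequality inside the continuation region. -/
theorem gradient_lt_in_continuation (θ σ : ℝ) (hθ : 0 < θ) (hσ : 0 < σ)
    (μ : Measure ℝ) [IsProbabilityMeasure μ] (hsupp : ∀ᵐ y ∂μ, 0 ≤ y)
    (hint : Integrable (fun y : ℝ => y) μ) (hmean : 0 < ∫ y, y ∂μ)
    (β : ℝ) (hβ₁ : mseY θ σ μ ≤ β) (hβ₂ : β < mseInf θ σ)
    (vstar : ℝ) (hvstar : 0 ≤ vstar)
    (heq : (mseInf θ σ - β) * G (Real.sqrt θ / σ * vstar) = mseInf θ σ - mseY θ σ μ) :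
    ∀ v : ℝ, 0 < v → v < vstar →
      -(v / θ) + (σ / θ ^ ((3:ℝ)/2) - 2 * β / (σ * Real.sqrt θ)) * F (Real.sqrt θ / σ * v)
        < -(2 * gam θ μ * v) := by
  intro v hv hvs
  have hs : 0 < Real.sqrt θ := Real.sqrt_pos.2 hθ
  have hss : Real.sqrt θ ^ 2 = θ := Real.sq_sqrt hθ.le
  have hx : 0 < Real.sqrt θ / σ * v := by positivity
  have hG := G_lt _ (Real.sqrt θ / σ * vstar) hx
    (mul_lt_mul_of_pos_left hvs (by positivity))
  have hF : F (Real.sqrt θ / σ * v)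
      = (Real.sqrt θ / σ * v) * G (Real.sqrt θ / σ * v) := by
    unfold F G
    rw [if_neg hx.ne']
    generalize Real.sqrt θ / σ * v = x at hx
    field_simp
  have hpow : θ ^ ((3:ℝ)/2) = θ * Real.sqrt θ := by
    rw [Real.sqrt_eq_rpow, show (3:ℝ)/2 = 1 + 1/2 by norm_num, Real.rpow_add hθ, Real.rpow_one]
  have hlt := mul_lt_mul_of_pos_left hG (sub_pos.2 hβ₂)
  rw [heq] at hlt
  have hlt2 := mul_lt_mul_of_pos_left hlt (show 0 < 2 * v / σ ^ 2 by positivity)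
  rw [hF, hpow]
  generalize G (Real.sqrt θ / σ * v) = g at *
  have e1 : (σ / (θ * Real.sqrt θ) - 2 * β / (σ * Real.sqrt θ)) * (Real.sqrt θ / σ * v * g)
      = 2 * v / σ ^ 2 * ((mseInf θ σ - β) * g) := by
    unfold mseInf
    field_simp
  have e2 : 2 * v / σ ^ 2 * (mseInf θ σ - mseY θ σ μ) = v / θ - 2 * gam θ μ * v := by
    unfold mseInf mseY gam
    field_simp
  rw [e1]
  linarith
end

section
/- Key excessivity inequality at the threshold: let mse_Y ≤ β < mse_∞ and let v_* ≥ 0 satisfy (mse_∞ − β)·G((√θ/σ)·v_*) = mse_∞ − mse_Y. Then (∫ e^{−2θy} dμ(y))·v_*² ≥ β − mse_Y. -/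
open Real MeasureTheory Filter Set

theorem G_mul_le (x : ℝ) (hx : 0 ≤ x) : G x * (1 - 2 * x ^ 2) ≤ 1 := by
  rcases hx.eq_or_lt with rfl | hx
  · simp [G]
  have hd : ∀ t : ℝ, HasDerivAt (fun t : ℝ => t * Real.exp (-t ^ 2))
      ((1 - 2 * t ^ 2) * Real.exp (-t ^ 2)) t := by
    intro t
    have h1 : HasDerivAt (fun t : ℝ => -t ^ 2) (-(2 * t)) t := by
      exact (hasDerivAt_pow 2 t).neg.congr_deriv (by simp)
    have h2 := (hasDerivAt_id' t).mul h1.exp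
    refine h2.congr_deriv ?_
    ring
  have hI : ∫ t in (0:ℝ)..x, (1 - 2 * t ^ 2) * Real.exp (-t ^ 2) = x * Real.exp (-x ^ 2) := by
    rw [intervalIntegral.integral_eq_sub_of_hasDerivAt (fun t _ => hd t)
      (Continuous.intervalIntegrable (by fun_prop) _ _)]
    simp
  have hle : ∫ t in (0:ℝ)..x, (1 - 2 * x ^ 2) * Real.exp (-t ^ 2) ≤
      ∫ t in (0:ℝ)..x, (1 - 2 * t ^ 2) * Real.exp (-t ^ 2) := by
    apply intervalIntegral.integral_mono_on hx.le
      (Continuous.intervalIntegrable (by fun_prop) _ _)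
      (Continuous.intervalIntegrable (by fun_prop) _ _)
    intro t ht
    have : t ^ 2 ≤ x ^ 2 := pow_le_pow_left₀ ht.1 ht.2 2
    exact mul_le_mul_of_nonneg_right (by linarith) (Real.exp_pos _).le
  rw [hI, intervalIntegral.integral_const_mul] at hle
  have hG : G x = (Real.exp (x ^ 2) / x) * ∫ t in (0:ℝ)..x, Real.exp (-t ^ 2) := by
    simp [G, hx.ne']
  have hee : Real.exp (x ^ 2) * Real.exp (-x ^ 2) = 1 := by
    rw [← Real.exp_add]; simp
  calc G x * (1 - 2 * x ^ 2)
      = (Real.exp (x ^ 2) / x) * ((1 - 2 * x ^ 2) * ∫ t in (0:ℝ)..x, Real.exp (-t ^ 2)) := by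
        rw [hG]; ring
    _ ≤ (Real.exp (x ^ 2) / x) * (x * Real.exp (-x ^ 2)) :=
        mul_le_mul_of_nonneg_left hle (by positivity)
    _ = Real.exp (x ^ 2) * Real.exp (-x ^ 2) := by field_simp
    _ = 1 := hee

/-- Key excessivity inequality at the threshold:
`(∫ e^{-2θy} dμ(y)) v_*² ≥ β - mse_Y`. -/
theorem excessivity_at_threshold (θ σ : ℝ) (hθ : 0 < θ) (hσ : 0 < σ)
    (μ : Measure ℝ) [IsProbabilityMeasure μ] (hsupp : ∀ᵐ y ∂μ, 0 ≤ y)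
    (hint : Integrable (fun y : ℝ => y) μ) (hmean : 0 < ∫ y, y ∂μ)
    (β : ℝ) (hβ₁ : mseY θ σ μ ≤ β) (hβ₂ : β < mseInf θ σ)
    (vstar : ℝ) (hvstar : 0 ≤ vstar)
    (heq : (mseInf θ σ - β) * G (Real.sqrt θ / σ * vstar) = mseInf θ σ - mseY θ σ μ) :
    (∫ y, Real.exp (-(2 * θ * y)) ∂μ) * vstar ^ 2 ≥ β - mseY θ σ μ := by
  have hexp : Integrable (fun y : ℝ => Real.exp (-(2 * θ * y))) μ := by
    refine Integrable.mono' (integrable_const (1:ℝ))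
      (Continuous.aestronglyMeasurable (by fun_prop)) ?_
    filter_upwards [hsupp] with y hy
    rw [Real.norm_eq_abs, abs_of_pos (Real.exp_pos _)]
    exact Real.exp_le_one_iff.2 (by have := mul_nonneg hθ.le hy; linarith)
  have hY : mseY θ σ μ = mseInf θ σ * (1 - ∫ y, Real.exp (-(2 * θ * y)) ∂μ) := by
    rw [mseY, mseInf, integral_sub (integrable_const _) hexp]
    simp
  have hx : 0 ≤ Real.sqrt θ / σ * vstar := by positivity
  have hg := G_mul_le _ hx
  have hv : vstar ^ 2 = mseInf θ σ * (2 * (Real.sqrt θ / σ * vstar) ^ 2) := by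
    rw [mseInf, mul_pow, div_pow, Real.sq_sqrt hθ.le]
    field_simp
  generalize Real.sqrt θ / σ * vstar = x at *
  generalize (∫ y, Real.exp (-(2 * θ * y)) ∂μ) = L at *
  rw [hv]
  rw [hY] at heq ⊢
  have h := mul_le_mul_of_nonneg_left hg (sub_pos.2 hβ₂).le
  have h2 : (mseInf θ σ - β) * (G x * (1 - 2 * x ^ 2)) =
      (mseInf θ σ - mseInf θ σ * (1 - L)) * (1 - 2 * x ^ 2) := by
    rw [← heq]; ring
  rw [h2] at h
  nlinarith [h]
end

section
/- The function R₁ satisfies R₁(0) = 0, is twice differentiable on ℝ, and solves the ordinary differential equation (σ²/2)·R₁''(v) − θ·v·R₁'(v) = 1 for every v ∈ ℝ. -/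
open Real

/-- The error function `erf x = (2/√π) ∫_0^x e^{-t²} dt`. -/
noncomputable def erfFun (x : ℝ) : ℝ := 2 / Real.sqrt π * ∫ t in (0:ℝ)..x, Real.exp (-t ^ 2)

/-- `R₁ v = (√π/(σ√θ)) ∫_0^v erf((√θ/σ) u) e^{(θ/σ²) u²} du`. -/
noncomputable def R₁ (θ σ : ℝ) (v : ℝ) : ℝ :=
  Real.sqrt π / (σ * Real.sqrt θ) *
    ∫ u in (0:ℝ)..v, erfFun (Real.sqrt θ / σ * u) * Real.exp (θ / σ ^ 2 * u ^ 2)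

theorem erfFun_hasDerivAt (x : ℝ) :
    HasDerivAt erfFun (2 / Real.sqrt π * Real.exp (-x ^ 2)) x := by
  have hc : Continuous fun t : ℝ => Real.exp (-t ^ 2) := by fun_prop
  exact (hc.integral_hasStrictDerivAt 0 x).hasDerivAt.const_mul _

/-- `R₁ 0 = 0`, `R₁` is twice differentiable on `ℝ`, and solves
`(σ²/2) R₁'' v - θ v R₁' v = 1` for every `v`. -/
theorem R₁_solves_ODE (θ σ : ℝ) (hθ : 0 < θ) (hσ : 0 < σ) :
    R₁ θ σ 0 = 0 ∧
    (∀ v : ℝ, DifferentiableAt ℝ (R₁ θ σ) v) ∧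
    (∀ v : ℝ, DifferentiableAt ℝ (deriv (R₁ θ σ)) v) ∧
    (∀ v : ℝ, σ ^ 2 / 2 * deriv (deriv (R₁ θ σ)) v - θ * v * deriv (R₁ θ σ) v = 1) := by
  have hE : Continuous erfFun :=
    continuous_iff_continuousAt.2 fun x => (erfFun_hasDerivAt x).continuousAt
  have hc : Continuous fun u : ℝ =>
      erfFun (Real.sqrt θ / σ * u) * Real.exp (θ / σ ^ 2 * u ^ 2) := by fun_prop
  have h1 : ∀ v : ℝ, HasDerivAt (R₁ θ σ) (Real.sqrt π / (σ * Real.sqrt θ) *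
      (erfFun (Real.sqrt θ / σ * v) * Real.exp (θ / σ ^ 2 * v ^ 2))) v := fun v =>
    (hc.integral_hasStrictDerivAt 0 v).hasDerivAt.const_mul _
  have hd : deriv (R₁ θ σ) = fun v => Real.sqrt π / (σ * Real.sqrt θ) *
      (erfFun (Real.sqrt θ / σ * v) * Real.exp (θ / σ ^ 2 * v ^ 2)) :=
    funext fun v => (h1 v).deriv
  have h2 : ∀ v : ℝ, HasDerivAt (deriv (R₁ θ σ)) (Real.sqrt π / (σ * Real.sqrt θ) *
      ((2 / Real.sqrt π * Real.exp (-(Real.sqrt θ / σ * v) ^ 2) * (Real.sqrt θ / σ)) *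
        Real.exp (θ / σ ^ 2 * v ^ 2) +
      erfFun (Real.sqrt θ / σ * v) *
        (Real.exp (θ / σ ^ 2 * v ^ 2) * (θ / σ ^ 2 * (2 * v))))) v := by
    intro v
    rw [hd]
    have ha : HasDerivAt (fun u : ℝ => Real.sqrt θ / σ * u) (Real.sqrt θ / σ) v := by
      simpa using (hasDerivAt_id v).const_mul (Real.sqrt θ / σ)
    have hb : HasDerivAt (fun u : ℝ => θ / σ ^ 2 * u ^ 2) (θ / σ ^ 2 * (2 * v)) v := by
      simpa using (hasDerivAt_pow 2 v).const_mul (θ / σ ^ 2)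
    exact ((((erfFun_hasDerivAt (Real.sqrt θ / σ * v)).comp v ha).mul hb.exp)).const_mul _
  refine ⟨by simp [R₁], fun v => (h1 v).differentiableAt,
    fun v => (h2 v).differentiableAt, fun v => ?_⟩
  rw [(h2 v).deriv, (h1 v).deriv]
  have he : Real.exp (-(Real.sqrt θ / σ * v) ^ 2) = (Real.exp (θ / σ ^ 2 * v ^ 2))⁻¹ := by
    rw [← Real.exp_neg, mul_pow, div_pow, Real.sq_sqrt hθ.le]
  rw [he]
  have hs : Real.sqrt θ ≠ 0 := (Real.sqrt_pos.2 hθ).ne'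
  have hp : Real.sqrt π ≠ 0 := (Real.sqrt_pos.2 Real.pi_pos).ne'
  have hx := (Real.exp_pos (θ / σ ^ 2 * v ^ 2)).ne'
  generalize Real.exp (θ / σ ^ 2 * v ^ 2) = X at *
  generalize erfFun (Real.sqrt θ / σ * v) = Y at *
  have hσ' := hσ.ne'
  field_simp
  ring
end

section
/- The function R₂ satisfies R₂(0) = 0, is twice differentiable on ℝ, and solves the ordinary differential equation (σ²/2)·R₂''(v) − θ·v·R₂'(v) = v² for every v ∈ ℝ. -/
open Real

/-- `R₂ v = -v²/(2θ) + (σ²/(2θ)) R₁ v`. -/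
noncomputable def R₂ (θ σ : ℝ) (v : ℝ) : ℝ :=
  -v ^ 2 / (2 * θ) + σ ^ 2 / (2 * θ) * R₁ θ σ v

theorem erfFun_continuous : Continuous erfFun :=
  continuous_iff_continuousAt.2 fun x => (erfFun_hasDerivAt x).continuousAt

theorem R₂_hasDerivAt (θ σ v : ℝ) :
    HasDerivAt (R₂ θ σ) (-(2 * v) / (2 * θ) + σ ^ 2 / (2 * θ) * (Real.sqrt π / (σ * Real.sqrt θ) *
      (erfFun (Real.sqrt θ / σ * v) * Real.exp (θ / σ ^ 2 * v ^ 2)))) v := by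
  have hc : Continuous (fun u : ℝ =>
      erfFun (Real.sqrt θ / σ * u) * Real.exp (θ / σ ^ 2 * u ^ 2)) := by
    have := erfFun_continuous
    fun_prop
  have h1 := ((intervalIntegral.integral_hasDerivAt_right (hc.intervalIntegrable 0 v)
    (hc.stronglyMeasurableAtFilter _ _) hc.continuousAt).const_mul
      (Real.sqrt π / (σ * Real.sqrt θ))).const_mul (σ ^ 2 / (2 * θ))
  have h2 : HasDerivAt (fun v : ℝ => -v ^ 2 / (2 * θ)) (-(2 * v) / (2 * θ)) v := by
    have := ((hasDerivAt_pow 2 v).neg).div_const (2 * θ)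
    simpa using this
  exact h2.add h1

theorem R₂_deriv_hasDerivAt (θ σ v : ℝ) (hθ : 0 < θ) (hσ : 0 < σ) :
    HasDerivAt (deriv (R₂ θ σ)) (2 / σ ^ 2 * (v ^ 2 + θ * v * deriv (R₂ θ σ) v)) v := by
  have he : deriv (R₂ θ σ) = fun v => -(2 * v) / (2 * θ) + σ ^ 2 / (2 * θ) *
      (Real.sqrt π / (σ * Real.sqrt θ) *
      (erfFun (Real.sqrt θ / σ * v) * Real.exp (θ / σ ^ 2 * v ^ 2))) :=
    funext fun v => (R₂_hasDerivAt θ σ v).deriv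
  rw [he]
  have hl : HasDerivAt (fun v : ℝ => Real.sqrt θ / σ * v) (Real.sqrt θ / σ) v := by
    simpa using (hasDerivAt_id v).const_mul (Real.sqrt θ / σ)
  have h1 := (erfFun_hasDerivAt (Real.sqrt θ / σ * v)).comp v hl
  have h2 := ((hasDerivAt_pow 2 v).const_mul (θ / σ ^ 2)).exp
  have h3 := ((h1.mul h2).const_mul (Real.sqrt π / (σ * Real.sqrt θ))).const_mul (σ ^ 2 / (2 * θ))
  have h4 : HasDerivAt (fun v : ℝ => -(2 * v) / (2 * θ)) (-(2 * 1) / (2 * θ)) v :=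
    (((hasDerivAt_id v).const_mul 2).neg).div_const (2 * θ)
  refine (h4.add h3).congr_deriv ?_
  have hs : Real.sqrt θ ^ 2 = θ := Real.sq_sqrt hθ.le
  have hs0 : Real.sqrt θ ≠ 0 := (Real.sqrt_pos.2 hθ).ne'
  have hp0 : Real.sqrt π ≠ 0 := (Real.sqrt_pos.2 Real.pi_pos).ne'
  have hE : Real.exp (-(Real.sqrt θ / σ * v) ^ 2) = (Real.exp (θ / σ ^ 2 * v ^ 2))⁻¹ := by
    rw [← Real.exp_neg]
    congr 1
    rw [mul_pow, div_pow, hs]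
  have hX := (Real.exp_pos (θ / σ ^ 2 * v ^ 2)).ne'
  simp only [Function.comp_apply]
  rw [hE]
  generalize Real.exp (θ / σ ^ 2 * v ^ 2) = X at *
  generalize erfFun (Real.sqrt θ / σ * v) = F at *
  field_simp
  push_cast
  ring

/-- `R₂ 0 = 0`, `R₂` is twice differentiable on `ℝ`, and solves
`(σ²/2) R₂'' v - θ v R₂' v = v²` for every `v`. -/
theorem R₂_solves_ODE (θ σ : ℝ) (hθ : 0 < θ) (hσ : 0 < σ) :
    R₂ θ σ 0 = 0 ∧
    (∀ v : ℝ, DifferentiableAt ℝ (R₂ θ σ) v) ∧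
    (∀ v : ℝ, DifferentiableAt ℝ (deriv (R₂ θ σ)) v) ∧
    (∀ v : ℝ, σ ^ 2 / 2 * deriv (deriv (R₂ θ σ)) v - θ * v * deriv (R₂ θ σ) v = v ^ 2) := by
  refine ⟨by simp [R₂, R₁], fun v => (R₂_hasDerivAt θ σ v).differentiableAt,
    fun v => (R₂_deriv_hasDerivAt θ σ v hθ hσ).differentiableAt, fun v => ?_⟩
  rw [(R₂_deriv_hasDerivAt θ σ v hθ hσ).deriv]
  field_simp
  ring
end

section
/- General solution of the free-boundary ODE: for any constants β, C₁, C₂ ∈ ℝ, the function H(v) = −v²/(2θ) + (σ²/(2θ) − β)·R₁(v) + C₁·erfi((√θ/σ)·v) + C₂, where erfi(x) = (2/√π)·∫_0^x e^{t²} dt, is twice differentiable on ℝ and satisfies (σ²/2)·H''(v) − θ·v·H'(v) = v² − β for every v ∈ ℝ. -/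
open Real

/-- The imaginary error function `erfi x = (2/√π) ∫_0^x e^{t²} dt`. -/
noncomputable def erfiFun (x : ℝ) : ℝ := 2 / Real.sqrt π * ∫ t in (0:ℝ)..x, Real.exp (t ^ 2)

/-- The general solution of the free-boundary ODE:
`H v = -v²/(2θ) + (σ²/(2θ) - β) R₁ v + C₁ erfi((√θ/σ) v) + C₂`. -/
noncomputable def H (θ σ β C₁ C₂ : ℝ) (v : ℝ) : ℝ :=
  -v ^ 2 / (2 * θ) + (σ ^ 2 / (2 * θ) - β) * R₁ θ σ v
    + C₁ * erfiFun (Real.sqrt θ / σ * v) + C₂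

theorem erfiFun_hasDerivAt (x : ℝ) :
    HasDerivAt erfiFun (2 / Real.sqrt π * Real.exp (x ^ 2)) x := by
  have hc : Continuous (fun t : ℝ => Real.exp (t ^ 2)) := by fun_prop
  exact (hc.integral_hasStrictDerivAt 0 x).hasDerivAt.const_mul _

theorem R₁_hasDerivAt (θ σ v : ℝ) :
    HasDerivAt (R₁ θ σ) (Real.sqrt π / (σ * Real.sqrt θ) *
      (erfFun (Real.sqrt θ / σ * v) * Real.exp (θ / σ ^ 2 * v ^ 2))) v := by
  have he := erfFun_continuous
  have hc : Continuous (fun u : ℝ =>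
      erfFun (Real.sqrt θ / σ * u) * Real.exp (θ / σ ^ 2 * u ^ 2)) := by fun_prop
  exact (hc.integral_hasStrictDerivAt 0 v).hasDerivAt.const_mul _

/-- The first derivative of `H`. -/
noncomputable def H1 (θ σ β C₁ : ℝ) (v : ℝ) : ℝ :=
  -v / θ + (σ ^ 2 / (2 * θ) - β) * (Real.sqrt π / (σ * Real.sqrt θ) *
      (erfFun (Real.sqrt θ / σ * v) * Real.exp (θ / σ ^ 2 * v ^ 2)))
    + C₁ * (2 / Real.sqrt π * Real.exp (θ / σ ^ 2 * v ^ 2) * (Real.sqrt θ / σ))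

theorem sq_arg (θ σ v : ℝ) (hθ : 0 < θ) :
    (Real.sqrt θ / σ * v) ^ 2 = θ / σ ^ 2 * v ^ 2 := by
  rw [mul_pow, div_pow, Real.sq_sqrt hθ.le]

theorem H_hasDerivAt_s16 (θ σ : ℝ) (hθ : 0 < θ) (β C₁ C₂ v : ℝ) :
    HasDerivAt (H θ σ β C₁ C₂) (H1 θ σ β C₁ v) v := by
  have hl : HasDerivAt (fun v : ℝ => Real.sqrt θ / σ * v) (Real.sqrt θ / σ) v := by
    simpa using (hasDerivAt_id v).const_mul (Real.sqrt θ / σ)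
  have h1 : HasDerivAt (fun v : ℝ => -v ^ 2 / (2 * θ)) (-v / θ) v := by
    refine (((hasDerivAt_pow 2 v).neg).div_const (2 * θ)).congr_deriv ?_
    have := hθ.ne'
    norm_num
    field_simp
  have h3 := ((erfiFun_hasDerivAt (Real.sqrt θ / σ * v)).comp v hl).const_mul C₁
  rw [sq_arg θ σ v hθ] at h3
  exact ((h1.add ((R₁_hasDerivAt θ σ v).const_mul (σ ^ 2 / (2 * θ) - β))).add h3).add_const C₂

theorem H1_hasDerivAt (θ σ : ℝ) (hθ : 0 < θ) (hσ : 0 < σ) (β C₁ v : ℝ) :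
    HasDerivAt (H1 θ σ β C₁) (2 / σ ^ 2 * (v ^ 2 - β + θ * v * H1 θ σ β C₁ v)) v := by
  have hl : HasDerivAt (fun v : ℝ => Real.sqrt θ / σ * v) (Real.sqrt θ / σ) v := by
    simpa using (hasDerivAt_id v).const_mul (Real.sqrt θ / σ)
  have h1 : HasDerivAt (fun v : ℝ => -v / θ) (-1 / θ) v :=
    (hasDerivAt_id v).neg.div_const θ
  have hE : HasDerivAt (fun v : ℝ => Real.exp (θ / σ ^ 2 * v ^ 2))
      (Real.exp (θ / σ ^ 2 * v ^ 2) * (θ / σ ^ 2 * (2 * v))) v := by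
    have := ((hasDerivAt_pow 2 v).const_mul (θ / σ ^ 2)).exp
    simpa using this
  have he : HasDerivAt (fun v : ℝ => erfFun (Real.sqrt θ / σ * v))
      (2 / Real.sqrt π * (Real.exp (θ / σ ^ 2 * v ^ 2))⁻¹ * (Real.sqrt θ / σ)) v := by
    have := (erfFun_hasDerivAt (Real.sqrt θ / σ * v)).comp v hl
    rw [sq_arg θ σ v hθ, Real.exp_neg] at this
    exact this
  have h := (h1.add (((he.mul hE).const_mul (Real.sqrt π / (σ * Real.sqrt θ))).const_mul
    (σ ^ 2 / (2 * θ) - β))).add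
    (((hE.const_mul (2 / Real.sqrt π)).mul_const (Real.sqrt θ / σ)).const_mul C₁)
  refine HasDerivAt.congr_deriv (f := H1 θ σ β C₁) h ?_
  unfold H1
  have hEp := (Real.exp_pos (θ / σ ^ 2 * v ^ 2)).ne'
  generalize Real.exp (θ / σ ^ 2 * v ^ 2) = E at hEp ⊢
  generalize erfFun (Real.sqrt θ / σ * v) = F
  have hp : Real.sqrt π ≠ 0 := (Real.sqrt_pos.2 Real.pi_pos).ne'
  generalize Real.sqrt π = p at hp ⊢
  have hs : Real.sqrt θ ≠ 0 := (Real.sqrt_pos.2 hθ).ne'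
  have hsq : θ = Real.sqrt θ ^ 2 := (Real.sq_sqrt hθ.le).symm
  generalize Real.sqrt θ = s at hs hsq ⊢
  subst hsq
  have := hσ.ne'
  field_simp
  ring

/-- `H` is twice differentiable on `ℝ` and satisfies
`(σ²/2) H'' v - θ v H' v = v² - β` for every `v`. -/
theorem H_solves_ODE (θ σ : ℝ) (hθ : 0 < θ) (hσ : 0 < σ) (β C₁ C₂ : ℝ) :
    (∀ v : ℝ, DifferentiableAt ℝ (H θ σ β C₁ C₂) v) ∧
    (∀ v : ℝ, DifferentiableAt ℝ (deriv (H θ σ β C₁ C₂)) v) ∧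
    (∀ v : ℝ, σ ^ 2 / 2 * deriv (deriv (H θ σ β C₁ C₂)) v
      - θ * v * deriv (H θ σ β C₁ C₂) v = v ^ 2 - β) := by
  have hd : deriv (H θ σ β C₁ C₂) = H1 θ σ β C₁ :=
    funext fun v => (H_hasDerivAt_s16 θ σ hθ β C₁ C₂ v).deriv
  refine ⟨fun v => (H_hasDerivAt_s16 θ σ hθ β C₁ C₂ v).differentiableAt, fun v => ?_, fun v => ?_⟩
  · rw [hd]
    exact (H1_hasDerivAt θ σ hθ hσ β C₁ v).differentiableAt
  · rw [hd, (H1_hasDerivAt θ σ hθ hσ β C₁ v).deriv]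
    have := hσ.ne'
    field_simp
    ring
end

section
/- The free-boundary solution dominates the stopping payoff on the continuation region: let mse_Y ≤ β < mse_∞ and let v_* ≥ 0 satisfy (mse_∞ − β)·G((√θ/σ)·v_*) = mse_∞ − mse_Y. Then for every v with |v| ≤ v_*, one has R₂(v) − β·R₁(v) + γ·v² ≥ R₂(v_*) − β·R₁(v_*) + γ·v_*². (Equivalently, the value-function candidate H satisfies H(v) ≥ −γ·v² on [−v_*, v_*].) -/
open Real MeasureTheory Filter Set

/-- Substituted form of `G`. -/
noncomputable def KK (x : ℝ) : ℝ := ∫ s in (0:ℝ)..1, Real.exp (x ^ 2 * (1 - s ^ 2))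

theorem KK_cont : Continuous KK := by
  unfold KK
  apply intervalIntegral.continuous_parametric_intervalIntegral_of_continuous'
  fun_prop

theorem KK_neg (x : ℝ) : KK (-x) = KK x := by
  simp [KK]

theorem KK_mono {x y : ℝ} (hx : 0 ≤ x) (hxy : x ≤ y) : KK x ≤ KK y := by
  unfold KK
  apply intervalIntegral.integral_mono_on (by norm_num)
  · exact Continuous.intervalIntegrable (by fun_prop) _ _
  · exact Continuous.intervalIntegrable (by fun_prop) _ _
  · intro s hs
    have h1 : 0 ≤ 1 - s ^ 2 := by nlinarith [hs.1, hs.2]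
    have h2 : x ^ 2 ≤ y ^ 2 := by gcongr
    exact Real.exp_le_exp.mpr (mul_le_mul_of_nonneg_right h2 h1)

theorem KK_eq (x : ℝ) :
    Real.exp (x ^ 2) * ∫ t in (0:ℝ)..x, Real.exp (-t ^ 2) = x * KK x := by
  have h := intervalIntegral.mul_integral_comp_mul_left (a := 0) (b := 1)
    (f := fun t : ℝ => Real.exp (-t ^ 2)) x
  simp only [mul_zero, mul_one] at h
  rw [← h, mul_left_comm, ← intervalIntegral.integral_const_mul]
  unfold KK
  congr 2
  ext s
  rw [← Real.exp_add]
  congr 1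
  ring

theorem G_eq_s17 (x : ℝ) : G x = KK x := by
  unfold G
  split_ifs with h
  · simp [KK, h]
  · have := KK_eq x
    rw [div_mul_eq_mul_div, this]
    field_simp

theorem R₁_eq (θ σ : ℝ) (hθ : 0 < θ) (hσ : 0 < σ) (v : ℝ) :
    R₁ θ σ v = (1 / σ ^ 2) * ∫ u in (0:ℝ)..v, 2 * u * KK (Real.sqrt θ / σ * u) := by
  unfold R₁ erfFun
  rw [← intervalIntegral.integral_const_mul, ← intervalIntegral.integral_const_mul]
  congr 1
  ext u
  have h := KK_eq (Real.sqrt θ / σ * u)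
  have h2 : (Real.sqrt θ / σ * u) ^ 2 = θ / σ ^ 2 * u ^ 2 := by
    rw [mul_pow, div_pow, Real.sq_sqrt hθ.le]
  rw [h2] at h
  have hp : 0 < Real.sqrt π := Real.sqrt_pos.mpr Real.pi_pos
  have ht : 0 < Real.sqrt θ := Real.sqrt_pos.mpr hθ
  rw [mul_assoc (2 / Real.sqrt π), mul_comm (∫ t in (0:ℝ)..(Real.sqrt θ / σ * u), Real.exp (-t ^ 2)), h]
  field_simp

theorem R₁_neg (θ σ : ℝ) (hθ : 0 < θ) (hσ : 0 < σ) (v : ℝ) : R₁ θ σ (-v) = R₁ θ σ v := by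
  rw [R₁_eq θ σ hθ hσ, R₁_eq θ σ hθ hσ]
  congr 1
  have h := intervalIntegral.integral_comp_neg (a := 0) (b := v)
    (fun u : ℝ => 2 * u * KK (Real.sqrt θ / σ * u))
  rw [neg_zero] at h
  rw [intervalIntegral.integral_symm (-v) 0]
  simp only [mul_neg, neg_mul, KK_neg, intervalIntegral.integral_neg] at h
  linarith

theorem R₁_diff (θ σ : ℝ) (hθ : 0 < θ) (hσ : 0 < σ) (w v : ℝ) (hw : 0 ≤ w) (hwv : w ≤ v) :
    R₁ θ σ v - R₁ θ σ w ≤ 1 / σ ^ 2 * (KK (Real.sqrt θ / σ * v) * (v ^ 2 - w ^ 2)) := by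
  have hc : Continuous fun u : ℝ => 2 * u * KK (Real.sqrt θ / σ * u) := by
    have := KK_cont
    fun_prop
  rw [R₁_eq θ σ hθ hσ, R₁_eq θ σ hθ hσ, ← mul_sub,
    intervalIntegral.integral_interval_sub_left (hc.intervalIntegrable _ _)
      (hc.intervalIntegrable _ _)]
  apply mul_le_mul_of_nonneg_left _ (by positivity)
  calc ∫ u in w..v, 2 * u * KK (Real.sqrt θ / σ * u)
      ≤ ∫ u in w..v, (2 * KK (Real.sqrt θ / σ * v)) * u := by
        apply intervalIntegral.integral_mono_on hwv (hc.intervalIntegrable _ _)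
          (Continuous.intervalIntegrable (by fun_prop) _ _)
        intro u hu
        have hu0 : 0 ≤ u := hw.trans hu.1
        have := KK_mono (x := Real.sqrt θ / σ * u) (y := Real.sqrt θ / σ * v)
          (by positivity) (by gcongr; exact hu.2)
        nlinarith
    _ = _ := by
        rw [intervalIntegral.integral_const_mul, integral_id]
        ring

/-- The free-boundary solution dominates the stopping payoff on the continuation region:
for `|v| ≤ v_*`, `R₂ v - β R₁ v + γ v² ≥ R₂ v_* - β R₁ v_* + γ v_*²`. -/
theorem value_function_dominates (θ σ : ℝ) (hθ : 0 < θ) (hσ : 0 < σ)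
    (μ : Measure ℝ) [IsProbabilityMeasure μ] (hsupp : ∀ᵐ y ∂μ, 0 ≤ y)
    (hint : Integrable (fun y : ℝ => y) μ) (hmean : 0 < ∫ y, y ∂μ)
    (β : ℝ) (hβ₁ : mseY θ σ μ ≤ β) (hβ₂ : β < mseInf θ σ)
    (vstar : ℝ) (hvstar : 0 ≤ vstar)
    (heq : (mseInf θ σ - β) * G (Real.sqrt θ / σ * vstar) = mseInf θ σ - mseY θ σ μ) :
    ∀ v : ℝ, |v| ≤ vstar →
      R₂ θ σ v - β * R₁ θ σ v + gam θ μ * v ^ 2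
        ≥ R₂ θ σ vstar - β * R₁ θ σ vstar + gam θ μ * vstar ^ 2 := by
  intro v hv
  have habs : R₁ θ σ |v| = R₁ θ σ v := by
    rcases abs_choice v with h | h <;> rw [h]
    exact R₁_neg θ σ hθ hσ v
  have hd := R₁_diff θ σ hθ hσ |v| vstar (abs_nonneg v) hv
  rw [habs, sq_abs] at hd
  rw [G_eq_s17] at heq
  have hM : 0 < mseInf θ σ - β := by linarith
  have h1 := mul_le_mul_of_nonneg_left hd hM.le
  have h2 : (mseInf θ σ - β) * (1 / σ ^ 2 * (KK (Real.sqrt θ / σ * vstar) * (vstar ^ 2 - v ^ 2)))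
      = (1 / (2 * θ) - gam θ μ) * (vstar ^ 2 - v ^ 2) := by
    have : (mseInf θ σ - β) * (1 / σ ^ 2 * (KK (Real.sqrt θ / σ * vstar) * (vstar ^ 2 - v ^ 2)))
      = ((mseInf θ σ - β) * KK (Real.sqrt θ / σ * vstar)) * (1 / σ ^ 2 * (vstar ^ 2 - v ^ 2)) := by
      ring
    rw [this, heq]
    unfold mseInf mseY gam
    field_simp
  rw [h2] at h1
  unfold R₂
  unfold mseInf at h1
  rw [show -v ^ 2 / (2 * θ) = -(1 / (2 * θ) * v ^ 2) by ring,
    show -vstar ^ 2 / (2 * θ) = -(1 / (2 * θ) * vstar ^ 2) by ring]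
  linarith
end
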